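/- arXiv:1807.09027 — 4 statements merged into one kernel-verified Lean document; each statement's English description precedes it below -/
import Mathlib

section
/- Let d ≥ 1 be an integer and let 0 ≤ δ < d/2. Then there exists a constant C < ∞ such that for every measurable function g : ℝ^d → [0,∞], ∫_{ℝ^d} ( ∫_{ℝ^d} (max(|x|,|y|))^{-d} · ( max(|x|,|y|) / min(|x|,|y|) )^{δ} · g(y) dy )² dx ≤ C · ∫_{ℝ^d} g(y)² dy, the integrals being taken in the extended nonnegative reals. -/
open MeasureTheory Real

/-- **Schur test** on `L²` for a nonnegative symmetric kernel with a single weight `h`. -/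
theorem lintegral_sq_lintegral_mul_le_of_schur {α : Type*} [MeasurableSpace α] {μ : Measure α}
    [SFinite μ] {K : α → α → ENNReal} (hK : Measurable (Function.uncurry K))
    (hsymm : ∀ x y, K x y = K y x) {h : α → ENNReal} (hh : Measurable h)
    (h0 : ∀ᵐ x ∂μ, h x ≠ 0) (htop : ∀ᵐ x ∂μ, h x ≠ ⊤) {A : ENNReal}
    (hA : ∀ᵐ x ∂μ, ∫⁻ y, K x y * h y ∂μ ≤ A * h x) {g : α → ENNReal} (hg : Measurable g) :
    ∫⁻ x, (∫⁻ y, K x y * g y ∂μ) ^ 2 ∂μ ≤ A ^ 2 * ∫⁻ y, g y ^ 2 ∂μ := by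
  have hKx (x : α) : Measurable (K x) := hK.comp measurable_prodMk_left
  have cauchy (x : α) : (∫⁻ y, K x y * g y ∂μ) ^ 2 ≤
      (∫⁻ y, K x y * h y ∂μ) * ∫⁻ y, K x y * (g y ^ 2 / h y) ∂μ := by
    have hsplit : ∫⁻ y, K x y * g y ∂μ = ∫⁻ y, (K x y * h y) ^ (1 / 2 : ℝ) *
        (K x y * (g y ^ 2 / h y)) ^ (1 / 2 : ℝ) ∂μ := by
      refine lintegral_congr_ae ?_
      filter_upwards [h0, htop] with y hy0 hyt
      rw [← ENNReal.mul_rpow_of_nonneg _ _ (by norm_num)]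
      have : K x y * h y * (K x y * (g y ^ 2 / h y)) = (K x y * g y) ^ (2 : ℝ) := by
        rw [ENNReal.rpow_two, mul_mul_mul_comm, ENNReal.mul_div_cancel hy0 hyt]
        ring
      rw [this, ← ENNReal.rpow_mul]
      norm_num
    have hle := ENNReal.lintegral_mul_norm_pow_le (μ := μ) (p := 1 / 2) (q := 1 / 2)
      ((hKx x).mul hh).aemeasurable ((hKx x).mul ((hg.pow_const 2).div hh)).aemeasurable
      (by norm_num) (by norm_num) (by norm_num)
    rw [hsplit]
    refine (pow_le_pow_left' hle 2).trans_eq ?_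
    rw [← ENNReal.mul_rpow_of_nonneg _ _ (by norm_num), ← ENNReal.rpow_natCast,
      ← ENNReal.rpow_mul]
    norm_num
  have hmeas : Measurable (Function.uncurry fun x y ↦ h x * (K x y * (g y ^ 2 / h y))) :=
    (hh.comp measurable_fst).mul
      (hK.mul (((hg.pow_const 2).div hh).comp measurable_snd))
  calc ∫⁻ x, (∫⁻ y, K x y * g y ∂μ) ^ 2 ∂μ
      ≤ ∫⁻ x, A * ∫⁻ y, h x * (K x y * (g y ^ 2 / h y)) ∂μ ∂μ := by
        refine lintegral_mono_ae ?_
        filter_upwards [hA] with x hx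
        rw [lintegral_const_mul _ (by fun_prop), ← mul_assoc]
        exact (cauchy x).trans (mul_le_mul_left hx _)
    _ = A * ∫⁻ y, ∫⁻ x, h x * (K x y * (g y ^ 2 / h y)) ∂μ ∂μ := by
        rw [lintegral_const_mul _ (by exact hmeas.lintegral_prod_right'),
          lintegral_lintegral_swap hmeas.aemeasurable]
    _ = A * ∫⁻ y, g y ^ 2 / h y * ∫⁻ x, K y x * h x ∂μ ∂μ := by
        congr 1
        refine lintegral_congr fun y ↦ ?_
        rw [← lintegral_const_mul _ (by fun_prop)]
        refine lintegral_congr fun x ↦ ?_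
        rw [hsymm x y]
        ring
    _ ≤ A * ∫⁻ y, A * g y ^ 2 ∂μ := by
        refine mul_le_mul_right (lintegral_mono_ae ?_) _
        filter_upwards [hA, h0, htop] with y hy hy0 hyt
        calc g y ^ 2 / h y * ∫⁻ x, K y x * h x ∂μ ≤ g y ^ 2 / h y * (A * h y) :=
              mul_le_mul_right hy _
          _ = A * g y ^ 2 := by
              rw [mul_left_comm, ENNReal.div_mul_cancel hy0 hyt]
    _ = A ^ 2 * ∫⁻ y, g y ^ 2 ∂μ := by
        rw [lintegral_const_mul _ (hg.pow_const 2), sq, mul_assoc]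

/-- Change of variables under a dilation. -/
theorem lintegral_eq_mul_lintegral_comp_smul {E : Type*} [NormedAddCommGroup E] [NormedSpace ℝ E]
    [MeasurableSpace E] [BorelSpace E] [FiniteDimensional ℝ E] (μ : Measure E)
    [μ.IsAddHaarMeasure] {r : ℝ} (hr : 0 < r) (f : E → ENNReal) :
    ∫⁻ y, f y ∂μ = ENNReal.ofReal (r ^ Module.finrank ℝ E) * ∫⁻ z, f (r • z) ∂μ := by
  have hmap : ∫⁻ z, f (r • z) ∂μ = ∫⁻ y, f y ∂(μ.map (r • ·)) :=
    ((Homeomorph.smulOfNeZero r hr.ne').measurableEmbedding.lintegral_map f).symm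
  rw [hmap, Measure.map_addHaar_smul μ hr.ne', lintegral_smul_measure, smul_eq_mul, ← mul_assoc,
    ← ENNReal.ofReal_mul (by positivity), abs_of_pos (by positivity),
    mul_inv_cancel₀ (by positivity), ENNReal.ofReal_one, one_mul]

theorem lintegral_radial_kernel_lt_top {d : ℕ} (hd : 1 ≤ d) {δ : ℝ} (hδ : δ < (d : ℝ) / 2) :
    ∫⁻ z : EuclideanSpace ℝ (Fin d), ENNReal.ofReal ((max 1 ‖z‖) ^ (-(d : ℝ)) *
      (max 1 ‖z‖ / min 1 ‖z‖) ^ δ * ‖z‖ ^ (-((d : ℝ) / 2))) < ⊤ := by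
  have : Nonempty (Fin d) := ⟨⟨0, hd⟩⟩
  set f : ℝ → ℝ := fun r ↦ (max 1 r) ^ (-(d : ℝ)) * (max 1 r / min 1 r) ^ δ *
    r ^ (-((d : ℝ) / 2)) with hf
  have hint : Integrable (fun z : EuclideanSpace ℝ (Fin d) ↦ f ‖z‖) := by
    rw [integrable_fun_norm_addHaar, finrank_euclideanSpace, Fintype.card_fin,
      ← Set.Ioc_union_Ioi_eq_Ioi zero_le_one, integrableOn_union]
    constructor
    · have hp : IntegrableOn (fun r : ℝ ↦ r ^ ((d : ℝ) / 2 - 1 - δ)) (Set.Ioc 0 1) :=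
        (intervalIntegrable_iff_integrableOn_Ioc_of_le zero_le_one).1
          (intervalIntegral.intervalIntegrable_rpow' (by linarith))
      refine hp.congr_fun (fun r hr ↦ ?_) measurableSet_Ioc
      obtain ⟨hr0, hr1⟩ := hr
      simp only [hf, smul_eq_mul]
      rw [max_eq_left hr1, min_eq_right hr1, one_div, Real.inv_rpow hr0.le,
        ← Real.rpow_neg hr0.le, Real.one_rpow, one_mul, ← Real.rpow_natCast,
        ← Real.rpow_add hr0, ← Real.rpow_add hr0, Nat.cast_sub hd]
      congr 1
      push_cast
      ring
    · have hp : IntegrableOn (fun r : ℝ ↦ r ^ (δ - (d : ℝ) / 2 - 1)) (Set.Ioi 1) :=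
        integrableOn_Ioi_rpow_of_lt (by linarith) one_pos
      refine hp.congr_fun (fun r hr ↦ ?_) measurableSet_Ioi
      have hr1 : 1 ≤ r := le_of_lt hr
      have hr0 : 0 < r := by linarith
      simp only [hf, smul_eq_mul]
      rw [max_eq_right hr1, min_eq_left hr1, div_one, ← Real.rpow_natCast,
        ← Real.rpow_add hr0, ← Real.rpow_add hr0, ← Real.rpow_add hr0, Nat.cast_sub hd]
      congr 1
      push_cast
      ring
  exact hint.lintegral_lt_top

theorem radial_kernel_dilation {d : ℕ} (δ : ℝ) {r s : ℝ} (hr : 0 < r) (hs : 0 ≤ s) :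
    r ^ d * ((max r (r * s)) ^ (-(d : ℝ)) * (max r (r * s) / min r (r * s)) ^ δ *
      (r * s) ^ (-((d : ℝ) / 2))) =
    (max 1 s) ^ (-(d : ℝ)) * (max 1 s / min 1 s) ^ δ * s ^ (-((d : ℝ) / 2)) *
      r ^ (-((d : ℝ) / 2)) := by
  have hmax : max r (r * s) = r * max 1 s := by
    rw [mul_max_of_nonneg _ _ hr.le, mul_one]
  have hmin : min r (r * s) = r * min 1 s := by
    rw [mul_min_of_nonneg _ _ hr.le, mul_one]
  have hcancel : r ^ d * r ^ (-(d : ℝ)) = 1 := by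
    rw [← Real.rpow_natCast, ← Real.rpow_add hr, add_neg_cancel, Real.rpow_zero]
  rw [hmax, hmin, mul_div_mul_left _ _ hr.ne', Real.mul_rpow hr.le (by positivity),
    Real.mul_rpow hr.le hs]
  linear_combination ((max 1 s) ^ (-(d : ℝ)) * (max 1 s / min 1 s) ^ δ * s ^ (-((d : ℝ) / 2)) *
      r ^ (-((d : ℝ) / 2))) * hcancel

/-- Schur test: `L²`-boundedness of the integral operator with kernel
`(|x| ∨ |y|)^{-d} ((|x| ∨ |y|)/(|x| ∧ |y|))^δ` when `0 ≤ δ < d/2`. -/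
theorem schur_test_L_kernel (d : ℕ) (hd : 1 ≤ d) (δ : ℝ) (hδ0 : 0 ≤ δ)
    (hδ : δ < (d : ℝ) / 2) :
    ∃ C : ℝ, ∀ g : EuclideanSpace ℝ (Fin d) → ENNReal, Measurable g →
      (∫⁻ x : EuclideanSpace ℝ (Fin d),
        (∫⁻ y : EuclideanSpace ℝ (Fin d),
          ENNReal.ofReal ((max ‖x‖ ‖y‖) ^ (-(d : ℝ)) *
            ((max ‖x‖ ‖y‖) / (min ‖x‖ ‖y‖)) ^ δ) * g y) ^ 2)
        ≤ ENNReal.ofReal C * ∫⁻ y : EuclideanSpace ℝ (Fin d), (g y) ^ 2 := by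
  have : Nonempty (Fin d) := ⟨⟨0, hd⟩⟩
  set A := ∫⁻ z : EuclideanSpace ℝ (Fin d), ENNReal.ofReal ((max 1 ‖z‖) ^ (-(d : ℝ)) *
      (max 1 ‖z‖ / min 1 ‖z‖) ^ δ * ‖z‖ ^ (-((d : ℝ) / 2))) with hAdef
  have hAtop : A < ⊤ := lintegral_radial_kernel_lt_top hd hδ
  have hne : ∀ᵐ x : EuclideanSpace ℝ (Fin d), x ≠ 0 := by
    simp [ae_iff]
  refine ⟨(A ^ 2).toReal, fun g hg ↦ ?_⟩
  rw [ENNReal.ofReal_toReal (ENNReal.pow_lt_top hAtop).ne]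
  refine lintegral_sq_lintegral_mul_le_of_schur
    (K := fun x y : EuclideanSpace ℝ (Fin d) ↦ ENNReal.ofReal ((max ‖x‖ ‖y‖) ^ (-(d : ℝ)) *
            ((max ‖x‖ ‖y‖) / (min ‖x‖ ‖y‖)) ^ δ))
    (h := fun x ↦ ENNReal.ofReal (‖x‖ ^ (-((d : ℝ) / 2)))) ?_ (fun x y ↦ ?_) (by fun_prop) ?_
    (by simp) ?_ hg
  · unfold Function.uncurry
    fun_prop
  · rw [max_comm, min_comm]
  · filter_upwards [hne] with x hx
    have := norm_pos_iff.2 hx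
    exact (ENNReal.ofReal_pos.2 (by positivity)).ne'
  · filter_upwards [hne] with x hx
    have hx := norm_pos_iff.2 hx
    refine le_of_eq ?_
    rw [lintegral_eq_mul_lintegral_comp_smul volume hx, finrank_euclideanSpace, Fintype.card_fin,
      ← lintegral_const_mul _ (by fun_prop), hAdef, ← lintegral_mul_const _ (by fun_prop)]
    refine lintegral_congr fun z ↦ ?_
    rw [norm_smul, norm_norm, ← ENNReal.ofReal_mul (by positivity),
      ← ENNReal.ofReal_mul (by positivity), ← ENNReal.ofReal_mul (by positivity),
      radial_kernel_dilation δ hx (norm_nonneg z)]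
end

section
/- Let d ≥ 1 be an integer, α > 0, 0 ≤ δ and 0 < s < 2 with sα/2 + d − 2δ > 0. For x, y ∈ ℝ^d ∖ {0} and t > 0 set L_t(x,y) = 𝟙{(max(|x|,|y|))^α ≤ t} · t^{-d/α} · ( t^{2/α} / (|x||y|) )^{δ} + 𝟙{(max(|x|,|y|))^α ≥ t} · t · (max(|x|,|y|))^{-(d+α)} · ( max(1, t^{1/α}/min(|x|,|y|)) )^{δ}. Then there exist constants 0 < c ≤ C < ∞ such that for all x, y ∈ ℝ^d ∖ {0}: c · R ≤ ∫₀^∞ t^{-s/2 - 1} L_t(x,y) dt ≤ C · R, where R = (max(|x|,|y|))^{-(sα/2 + d)} · ( max(|x|,|y|) / min(|x|,|y|) )^{δ}. -/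
open MeasureTheory Real

/-- The kernel `L_t(x,y)` bounding the off-diagonal part of the difference of heat kernels. -/
noncomputable def Lker (d : ℕ) (α δ : ℝ) (t : ℝ) (x y : EuclideanSpace ℝ (Fin d)) : ℝ :=
  (if (max ‖x‖ ‖y‖) ^ α ≤ t then
      t ^ (-(d : ℝ) / α) * (t ^ (2 / α) / (‖x‖ * ‖y‖)) ^ δ
    else 0)
  + (if t ≤ (max ‖x‖ ‖y‖) ^ α then
      t * (max ‖x‖ ‖y‖) ^ (-((d : ℝ) + α)) * (max 1 (t ^ (1 / α) / min ‖x‖ ‖y‖)) ^ δ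
    else 0)

theorem setLIntegral_Ioi_rpow {b T : ℝ} (hb : b < -1) (hT : 0 < T) :
    ∫⁻ t in Set.Ioi T, ENNReal.ofReal (t ^ b) = ENNReal.ofReal (T ^ (b + 1) / -(b + 1)) := by
  rw [← ofReal_integral_eq_lintegral_ofReal (integrableOn_Ioi_rpow_of_lt hb hT),
    integral_Ioi_rpow_of_lt hb hT, div_neg, neg_div]
  filter_upwards [ae_restrict_mem measurableSet_Ioi] with t ht
  exact rpow_nonneg (hT.trans ht).le b

theorem setLIntegral_Ioc_rpow {b T : ℝ} (hb : -1 < b) (hT : 0 < T) :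
    ∫⁻ t in Set.Ioc 0 T, ENNReal.ofReal (t ^ b) = ENNReal.ofReal (T ^ (b + 1) / (b + 1)) := by
  have hint : IntegrableOn (fun t : ℝ => t ^ b) (Set.Ioc 0 T) :=
    (intervalIntegrable_iff_integrableOn_Ioc_of_le hT.le).1
      (intervalIntegral.intervalIntegrable_rpow' hb)
  rw [← ofReal_integral_eq_lintegral_ofReal hint, ← intervalIntegral.integral_of_le hT.le,
    integral_rpow (Or.inl hb), zero_rpow (by linarith), sub_zero]
  filter_upwards [ae_restrict_mem measurableSet_Ioc] with t ht
  exact rpow_nonneg ht.1.le b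

section

variable {d : ℕ} {α δ s t : ℝ} {x y : EuclideanSpace ℝ (Fin d)}

theorem rpow_mul_Lker_of_lt (hx : x ≠ 0) (hy : y ≠ 0)
    (ht : max ‖x‖ ‖y‖ ^ α < t) :
    t ^ (-s / 2 - 1) * Lker d α δ t x y =
      (max ‖x‖ ‖y‖ * min ‖x‖ ‖y‖) ^ (-δ) * t ^ (-s / 2 - 1 - d / α + 2 / α * δ) := by
  have hx := norm_pos_iff.2 hx
  have hy := norm_pos_iff.2 hy
  have ht0 : 0 < t := lt_of_le_of_lt (by positivity) ht
  rw [Lker, if_pos ht.le, if_neg ht.not_ge, add_zero, max_mul_min,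
    div_rpow (by positivity) (by positivity), ← rpow_mul ht0.le, rpow_neg (by positivity),
    rpow_add ht0, sub_eq_add_neg _ ((d : ℝ) / α), rpow_add ht0, neg_div α (d : ℝ)]
  ring

theorem rpow_mul_Lker_le_of_lt (hα : 0 < α) (hδ : 0 ≤ δ) (hx : x ≠ 0) (hy : y ≠ 0)
    (ht0 : 0 < t) (ht : t < max ‖x‖ ‖y‖ ^ α) :
    t ^ (-s / 2 - 1) * Lker d α δ t x y ≤
      max ‖x‖ ‖y‖ ^ (-((d : ℝ) + α)) * (max ‖x‖ ‖y‖ / min ‖x‖ ‖y‖) ^ δ * t ^ (-s / 2) := by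
  have hx := norm_pos_iff.2 hx
  have hy := norm_pos_iff.2 hy
  have hm : 0 < min ‖x‖ ‖y‖ := lt_min hx hy
  have hM : 0 < max ‖x‖ ‖y‖ := lt_max_of_lt_left hx
  have hroot : t ^ (1 / α) ≤ max ‖x‖ ‖y‖ := by
    rw [one_div]
    exact (rpow_inv_le_iff_of_pos ht0.le hM.le hα).2 ht.le
  have hmax : max 1 (t ^ (1 / α) / min ‖x‖ ‖y‖) ≤ max ‖x‖ ‖y‖ / min ‖x‖ ‖y‖ :=
    max_le ((one_le_div hm).2 min_le_max) (by gcongr)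
  have hpow : t ^ (-s / 2) = t ^ (-s / 2 - 1) * t := by
    rw [← rpow_add_one ht0.ne', sub_add_cancel]
  rw [Lker, if_neg ht.not_ge, if_pos ht.le, zero_add, hpow]
  calc _ ≤ t ^ (-s / 2 - 1) * (t * max ‖x‖ ‖y‖ ^ (-((d : ℝ) + α)) *
        (max ‖x‖ ‖y‖ / min ‖x‖ ‖y‖) ^ δ) := by gcongr
    _ = _ := by ring

theorem setLIntegral_Ioi_Lker (hα : 0 < α) (h : s * α / 2 + (d : ℝ) - 2 * δ > 0)
    (hx : x ≠ 0) (hy : y ≠ 0) :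
    ∫⁻ t in Set.Ioi (max ‖x‖ ‖y‖ ^ α), ENNReal.ofReal (t ^ (-s / 2 - 1) * Lker d α δ t x y) =
      ENNReal.ofReal (α / (s * α / 2 + d - 2 * δ) * (max ‖x‖ ‖y‖ ^ (-(s * α / 2 + (d : ℝ))) *
        (max ‖x‖ ‖y‖ / min ‖x‖ ‖y‖) ^ δ)) := by
  have hm : 0 < min ‖x‖ ‖y‖ := lt_min (norm_pos_iff.2 hx) (norm_pos_iff.2 hy)
  have hM : 0 < max ‖x‖ ‖y‖ := hm.trans_le min_le_max
  have hexp : -s / 2 - 1 - d / α + 2 / α * δ + 1 = -((s * α / 2 + d - 2 * δ) / α) := by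
    field_simp
    ring
  have hpos : 0 < (s * α / 2 + d - 2 * δ) / α := div_pos h hα
  rw [setLIntegral_congr_fun measurableSet_Ioi fun t ht =>
    congrArg ENNReal.ofReal (rpow_mul_Lker_of_lt hx hy ht)]
  simp_rw [ENNReal.ofReal_mul (rpow_nonneg (mul_pos hM hm).le (-δ))]
  rw [lintegral_const_mul' _ _ ENNReal.ofReal_ne_top,
    setLIntegral_Ioi_rpow (by linarith) (rpow_pos_of_pos hM α), hexp, ← rpow_mul hM.le,
    ← ENNReal.ofReal_mul (rpow_nonneg (mul_pos hM hm).le (-δ)), neg_neg]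
  congr 1
  generalize max ‖x‖ ‖y‖ = M at *
  generalize min ‖x‖ ‖y‖ = m at *
  have hMexp : M ^ (α * -((s * α / 2 + d - 2 * δ) / α)) =
      M ^ (-(s * α / 2 + (d : ℝ))) * (M ^ δ * M ^ δ) := by
    rw [← rpow_add hM, ← rpow_add hM]
    congr 1
    field_simp
    ring
  rw [hMexp, mul_rpow hM.le hm.le, rpow_neg hM.le, rpow_neg hm.le, div_rpow hM.le hm.le]
  have := (rpow_pos_of_pos hM δ).ne'
  have := (rpow_pos_of_pos hm δ).ne'
  field_simp

theorem setLIntegral_Ioc_Lker_le (hα : 0 < α) (hδ : 0 ≤ δ) (hs2 : s < 2)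
    (hx : x ≠ 0) (hy : y ≠ 0) :
    ∫⁻ t in Set.Ioc 0 (max ‖x‖ ‖y‖ ^ α), ENNReal.ofReal (t ^ (-s / 2 - 1) * Lker d α δ t x y) ≤
      ENNReal.ofReal (1 / (1 - s / 2) * (max ‖x‖ ‖y‖ ^ (-(s * α / 2 + (d : ℝ))) *
        (max ‖x‖ ‖y‖ / min ‖x‖ ‖y‖) ^ δ)) := by
  have hm : 0 < min ‖x‖ ‖y‖ := lt_min (norm_pos_iff.2 hx) (norm_pos_iff.2 hy)
  have hM : 0 < max ‖x‖ ‖y‖ := hm.trans_le min_le_max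
  have hK : 0 ≤ max ‖x‖ ‖y‖ ^ (-((d : ℝ) + α)) * (max ‖x‖ ‖y‖ / min ‖x‖ ‖y‖) ^ δ := by
    positivity
  calc _ = ∫⁻ t in Set.Ioo 0 (max ‖x‖ ‖y‖ ^ α),
        ENNReal.ofReal (t ^ (-s / 2 - 1) * Lker d α δ t x y) :=
        (setLIntegral_congr Ioo_ae_eq_Ioc).symm
    _ ≤ ∫⁻ t in Set.Ioo 0 (max ‖x‖ ‖y‖ ^ α), ENNReal.ofReal
        (max ‖x‖ ‖y‖ ^ (-((d : ℝ) + α)) * (max ‖x‖ ‖y‖ / min ‖x‖ ‖y‖) ^ δ * t ^ (-s / 2)) :=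
        setLIntegral_mono' measurableSet_Ioo fun t ht =>
          ENNReal.ofReal_le_ofReal (rpow_mul_Lker_le_of_lt hα hδ hx hy ht.1 ht.2)
    _ = _ := by
      rw [setLIntegral_congr Ioo_ae_eq_Ioc]
      simp_rw [ENNReal.ofReal_mul hK]
      rw [lintegral_const_mul' _ _ ENNReal.ofReal_ne_top,
        setLIntegral_Ioc_rpow (by linarith) (rpow_pos_of_pos hM α), ← ENNReal.ofReal_mul hK,
        ← rpow_mul hM.le]
      congr 1
      have hMexp : max ‖x‖ ‖y‖ ^ (-(s * α / 2 + (d : ℝ))) =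
          max ‖x‖ ‖y‖ ^ (-((d : ℝ) + α)) * max ‖x‖ ‖y‖ ^ (α * (-s / 2 + 1)) := by
        rw [← rpow_add hM]
        congr 1
        ring
      rw [hMexp, show -s / 2 + 1 = 1 - s / 2 by ring]
      ring

end

/-- Two-sided bound for `∫₀^∞ t^{-s/2-1} L_t(x,y) dt` in terms of
`R = (|x| ∨ |y|)^{-(sα/2+d)} ((|x| ∨ |y|)/(|x| ∧ |y|))^δ`, uniformly in `x, y ≠ 0`. -/
theorem L_kernel_time_integral (d : ℕ) (hd : 1 ≤ d) (α δ s : ℝ) (hα : 0 < α) (hδ : 0 ≤ δ)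
    (hs0 : 0 < s) (hs2 : s < 2) (h : s * α / 2 + (d : ℝ) - 2 * δ > 0) :
    ∃ c C : ℝ, 0 < c ∧ c ≤ C ∧
      ∀ x y : EuclideanSpace ℝ (Fin d), x ≠ 0 → y ≠ 0 →
        ENNReal.ofReal (c * ((max ‖x‖ ‖y‖) ^ (-(s * α / 2 + (d : ℝ))) *
            ((max ‖x‖ ‖y‖) / (min ‖x‖ ‖y‖)) ^ δ)) ≤
          (∫⁻ t in Set.Ioi (0 : ℝ),
            ENNReal.ofReal (t ^ (-s / 2 - 1) * Lker d α δ t x y)) ∧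
        (∫⁻ t in Set.Ioi (0 : ℝ),
            ENNReal.ofReal (t ^ (-s / 2 - 1) * Lker d α δ t x y)) ≤
          ENNReal.ofReal (C * ((max ‖x‖ ‖y‖) ^ (-(s * α / 2 + (d : ℝ))) *
            ((max ‖x‖ ‖y‖) / (min ‖x‖ ‖y‖)) ^ δ)) := by
  have hc : 0 < α / (s * α / 2 + d - 2 * δ) := div_pos hα h
  have hc' : 0 < 1 / (1 - s / 2) := one_div_pos.2 (by linarith)
  refine ⟨α / (s * α / 2 + d - 2 * δ), α / (s * α / 2 + d - 2 * δ) + 1 / (1 - s / 2), hc,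
    by linarith, fun x y hx hy => ?_⟩
  have hm : 0 < min ‖x‖ ‖y‖ := lt_min (norm_pos_iff.2 hx) (norm_pos_iff.2 hy)
  have hM : 0 < max ‖x‖ ‖y‖ := hm.trans_le min_le_max
  have hT : 0 < max ‖x‖ ‖y‖ ^ α := rpow_pos_of_pos hM α
  rw [← Set.Ioc_union_Ioi_eq_Ioi hT.le, lintegral_union measurableSet_Ioi
    (Set.Ioc_disjoint_Ioi le_rfl), setLIntegral_Ioi_Lker hα h hx hy]
  refine ⟨le_add_self, ?_⟩
  rw [add_mul, ENNReal.ofReal_add (by positivity) (by positivity), add_comm]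
  gcongr
  exact setLIntegral_Ioc_Lker_le hα hδ hs2 hx hy
end

section
/- Let d ≥ 1 be an integer, α > 0 and 0 < s < 2. For x, y ∈ ℝ^d ∖ {0} and t > 0 set M_t(x,y) = 𝟙{(max(|x|,|y|))^α ≥ t} · 𝟙{|x|/2 ≤ |y| ≤ 2|x|} · t^{1 - d/α} · (min(|x|,|y|))^{-α} · min(1, t^{1+d/α}/|x−y|^{d+α}). Then there exists a constant C < ∞ such that for every y ∈ ℝ^d ∖ {0}: ∫_{ℝ^d} ∫₀^∞ t^{-s/2 - 1} · M_t(x,y) · (|x||y|)^{αs/4} dt dx ≤ C. -/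
open MeasureTheory Real
open scoped Classical

/-- The kernel `M_t(x,y)` bounding the diagonal part of the difference of heat kernels. -/
noncomputable def Mker (d : ℕ) (α : ℝ) (t : ℝ) (x y : EuclideanSpace ℝ (Fin d)) : ℝ :=
  if t ≤ (max ‖x‖ ‖y‖) ^ α ∧ ‖x‖ / 2 ≤ ‖y‖ ∧ ‖y‖ ≤ 2 * ‖x‖ then
    t ^ (1 - (d : ℝ) / α) * (min ‖x‖ ‖y‖) ^ (-α) *
      min 1 (t ^ (1 + (d : ℝ) / α) / ‖x - y‖ ^ ((d : ℝ) + α))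
  else 0

lemma min_one_inv_rpow_le {r p : ℝ} (hr : 0 ≤ r) (hp : 0 < p) :
    min 1 (r ^ p)⁻¹ ≤ 2 ^ p * (1 + r) ^ (-p) := by
  have key : 2 ^ p * (1 + r) ^ (-p) = ((1 + r) / 2) ^ (-p) := by
    rw [div_rpow (by positivity) (by norm_num), rpow_neg (by norm_num : (0 : ℝ) ≤ 2)]
    field_simp
  rw [key]
  rcases le_total r 1 with h | h
  · exact (min_le_left _ _).trans
      (one_le_rpow_of_pos_of_le_one_of_nonpos (by positivity) (by linarith) (by linarith))
  · refine (min_le_right _ _).trans ?_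
    rw [← rpow_neg hr]
    exact rpow_le_rpow_of_nonpos (by positivity) (by linarith) (by linarith)

/-- Integrating over space the heat-type profile at time `t` gives a value independent of `t`. -/
lemma lintegral_rescaled_profile (d : ℕ) {α t : ℝ} (ht : 0 < t)
    (y : EuclideanSpace ℝ (Fin d)) {g : EuclideanSpace ℝ (Fin d) → ENNReal} (hg : Measurable g) :
    ∫⁻ x, ENNReal.ofReal (t ^ (-(d : ℝ) / α)) * g (t ^ (-1 / α) • (x - y)) = ∫⁻ z, g z := by
  have hc : 0 < t ^ (-1 / α) := by positivity
  rw [lintegral_const_mul _ (by fun_prop),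
    lintegral_sub_right_eq_self (fun x => g (t ^ (-1 / α) • x)) y,
    ← lintegral_map hg (by fun_prop : Measurable fun x : EuclideanSpace ℝ (Fin d) =>
      t ^ (-1 / α) • x),
    Measure.map_addHaar_smul _ hc.ne', lintegral_smul_measure, smul_eq_mul, ← mul_assoc,
    ← ENNReal.ofReal_mul (by positivity)]
  have : t ^ (-(d : ℝ) / α) * |((t ^ (-1 / α)) ^ Module.finrank ℝ (EuclideanSpace ℝ (Fin d)))⁻¹|
      = 1 := by
    rw [abs_of_pos (by positivity), finrank_euclideanSpace_fin, ← rpow_mul_natCast ht.le,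
      ← rpow_neg ht.le, ← rpow_add ht]
    convert rpow_zero t using 2
    ring
  rw [this, ENNReal.ofReal_one, one_mul]

lemma lintegral_indicator_rpow {T r : ℝ} (hT : 0 ≤ T) (hr : -1 < r) :
    ∫⁻ t in Set.Ioi (0 : ℝ), (Set.Iic T).indicator (fun t => ENNReal.ofReal (t ^ r)) t
      = ENNReal.ofReal (T ^ (r + 1) / (r + 1)) := by
  rw [lintegral_indicator measurableSet_Iic, Measure.restrict_restrict measurableSet_Iic,
    Set.inter_comm, Set.Ioi_inter_Iic, ← ofReal_integral_eq_lintegral_ofReal,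
    ← intervalIntegral.integral_of_le hT, integral_rpow (Or.inl hr),
    zero_rpow (by linarith), sub_zero]
  · exact (intervalIntegrable_iff_integrableOn_Ioc_of_le hT).1
      (intervalIntegral.intervalIntegrable_rpow' hr)
  · filter_upwards [ae_restrict_mem measurableSet_Ioc] with t ht
    exact rpow_nonneg ht.1.le _

lemma Mker_weighted_le (d : ℕ) {α s t : ℝ} (hα : 0 < α) (hs : 0 < s) (ht : 0 < t)
    (x : EuclideanSpace ℝ (Fin d)) {y : EuclideanSpace ℝ (Fin d)} (hy : y ≠ 0)
    (htT : t ≤ (max ‖x‖ ‖y‖) ^ α) (hxy : ‖x‖ / 2 ≤ ‖y‖) (hyx : ‖y‖ ≤ 2 * ‖x‖) :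
    t ^ (-s / 2 - 1) * Mker d α t x y * (‖x‖ * ‖y‖) ^ (α * s / 4) ≤
      (‖y‖ / 2) ^ (-α) * (2 * ‖y‖ ^ 2) ^ (α * s / 4) * 2 ^ ((d : ℝ) + α) *
        (t ^ (-s / 2) * (t ^ (-(d : ℝ) / α) *
          (1 + ‖t ^ (-1 / α) • (x - y)‖) ^ (-((d : ℝ) + α)))) := by
  have hy0 : 0 < ‖y‖ := norm_pos_iff.2 hy
  have hp : 0 < (d : ℝ) + α := by positivity
  have hx0 : 0 < ‖x‖ := by linarith
  have h1 : (min ‖x‖ ‖y‖) ^ (-α) ≤ (‖y‖ / 2) ^ (-α) :=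
    rpow_le_rpow_of_nonpos (by positivity) (le_min (by linarith) (by linarith)) (by linarith)
  have h2 : (‖x‖ * ‖y‖) ^ (α * s / 4) ≤ (2 * ‖y‖ ^ 2) ^ (α * s / 4) :=
    rpow_le_rpow (by positivity) (by nlinarith) (by positivity)
  have h3 : min 1 (t ^ (1 + (d : ℝ) / α) / ‖x - y‖ ^ ((d : ℝ) + α)) ≤
      2 ^ ((d : ℝ) + α) * (1 + ‖t ^ (-1 / α) • (x - y)‖) ^ (-((d : ℝ) + α)) := by
    have h := min_one_inv_rpow_le (norm_nonneg (t ^ (-1 / α) • (x - y))) hp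
    convert h using 2
    rw [norm_smul, Real.norm_of_nonneg (by positivity), mul_rpow (by positivity) (norm_nonneg _),
      ← rpow_mul ht.le, mul_inv, ← rpow_neg ht.le, div_eq_mul_inv]
    congr 2
    field_simp
    ring
  have e : t ^ (-s / 2 - 1) * t ^ (1 - (d : ℝ) / α) = t ^ (-s / 2) * t ^ (-(d : ℝ) / α) := by
    rw [← rpow_add ht, ← rpow_add ht]
    congr 1
    ring
  rw [Mker, if_pos ⟨htT, hxy, hyx⟩]
  calc _ = (t ^ (-s / 2 - 1) * t ^ (1 - (d : ℝ) / α)) * ((min ‖x‖ ‖y‖) ^ (-α) *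
        min 1 (t ^ (1 + (d : ℝ) / α) / ‖x - y‖ ^ ((d : ℝ) + α)) *
        (‖x‖ * ‖y‖) ^ (α * s / 4)) := by ring
    _ ≤ (t ^ (-s / 2 - 1) * t ^ (1 - (d : ℝ) / α)) * ((‖y‖ / 2) ^ (-α) *
        (2 ^ ((d : ℝ) + α) * (1 + ‖t ^ (-1 / α) • (x - y)‖) ^ (-((d : ℝ) + α))) *
        (2 * ‖y‖ ^ 2) ^ (α * s / 4)) := by
      gcongr
    _ = _ := by
      rw [e]
      ring

lemma scaling_constant {r α s : ℝ} (hr : 0 < r) (d : ℕ) :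
    (r / 2) ^ (-α) * (2 * r ^ 2) ^ (α * s / 4) * 2 ^ ((d : ℝ) + α) *
      (((2 * r) ^ α) ^ (-s / 2 + 1) / (-s / 2 + 1)) =
    (1 / 2) ^ (-α) * 2 ^ (α * s / 4) * 2 ^ ((d : ℝ) + α) *
      ((2 ^ α) ^ (-s / 2 + 1) / (-s / 2 + 1)) := by
  have h : r ^ (-α) * (r ^ 2) ^ (α * s / 4) * (r ^ α) ^ (-s / 2 + 1) = 1 := by
    rw [← rpow_natCast, ← rpow_mul hr.le, ← rpow_mul hr.le, ← rpow_add hr, ← rpow_add hr]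
    convert rpow_zero r using 2
    push_cast
    ring
  rw [show r / 2 = r * (1 / 2) by ring, mul_rpow hr.le (by norm_num),
    mul_rpow (by norm_num) (by positivity), mul_rpow (by norm_num) hr.le,
    mul_rpow (by positivity) (by positivity)]
  linear_combination ((1 / 2) ^ (-α) * 2 ^ (α * s / 4) * 2 ^ ((d : ℝ) + α) *
      ((2 ^ α) ^ (-s / 2 + 1) / (-s / 2 + 1))) * h

/-- Uniform Schur-test bound:
`∫_{ℝ^d} ∫₀^∞ t^{-s/2-1} M_t(x,y) (|x||y|)^{αs/4} dt dx ≤ C` for all `y ≠ 0`. -/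
theorem M_kernel_schur_bound (d : ℕ) (hd : 1 ≤ d) (α s : ℝ) (hα : 0 < α)
    (hs0 : 0 < s) (hs2 : s < 2) :
    ∃ C : ℝ, ∀ y : EuclideanSpace ℝ (Fin d), y ≠ 0 →
      (∫⁻ x : EuclideanSpace ℝ (Fin d), ∫⁻ t in Set.Ioi (0 : ℝ),
        ENNReal.ofReal (t ^ (-s / 2 - 1) * Mker d α t x y * (‖x‖ * ‖y‖) ^ (α * s / 4)))
        ≤ ENNReal.ofReal C := by
  set g : EuclideanSpace ℝ (Fin d) → ENNReal :=
    fun z => ENNReal.ofReal ((1 + ‖z‖) ^ (-((d : ℝ) + α))) with hg_def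
  have hg : Measurable g := by fun_prop
  have hK : ∫⁻ z, g z ≠ ⊤ := (finite_integral_one_add_norm (by simpa using hα)).ne
  refine ⟨(1 / 2) ^ (-α) * 2 ^ (α * s / 4) * 2 ^ ((d : ℝ) + α) *
      ((2 ^ α) ^ (-s / 2 + 1) / (-s / 2 + 1)) * (∫⁻ z, g z).toReal, fun y hy => ?_⟩
  have hy0 : 0 < ‖y‖ := norm_pos_iff.2 hy
  set A : ℝ := (‖y‖ / 2) ^ (-α) * (2 * ‖y‖ ^ 2) ^ (α * s / 4) * 2 ^ ((d : ℝ) + α) with hA_def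
  have hA : 0 ≤ A := by positivity
  set T : ℝ := (2 * ‖y‖) ^ α with hT_def
  have hT : 0 ≤ T := by positivity
  set φ : ℝ → ENNReal := (Set.Iic T).indicator (fun t => ENNReal.ofReal (t ^ (-s / 2))) with hφ_def
  have hφ : Measurable φ := Measurable.indicator (by fun_prop) measurableSet_Iic
  have bound : ∀ x, ∀ t ∈ Set.Ioi (0 : ℝ),
      ENNReal.ofReal (t ^ (-s / 2 - 1) * Mker d α t x y * (‖x‖ * ‖y‖) ^ (α * s / 4)) ≤
      ENNReal.ofReal A * (φ t *
        (ENNReal.ofReal (t ^ (-(d : ℝ) / α)) * g (t ^ (-1 / α) • (x - y)))) := by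
    intro x t ht
    have ht0 : 0 < t := ht
    by_cases hc : t ≤ (max ‖x‖ ‖y‖) ^ α ∧ ‖x‖ / 2 ≤ ‖y‖ ∧ ‖y‖ ≤ 2 * ‖x‖
    · obtain ⟨h1, h2, h3⟩ := hc
      have htT : t ≤ T := h1.trans
        (rpow_le_rpow (by positivity) (max_le (by linarith) (by linarith)) hα.le)
      rw [hφ_def, Set.indicator_of_mem (Set.mem_Iic.2 htT), hg_def,
        ← ENNReal.ofReal_mul (by positivity), ← ENNReal.ofReal_mul (by positivity),
        ← ENNReal.ofReal_mul hA]
      exact ENNReal.ofReal_le_ofReal (Mker_weighted_le d hα hs0 ht0 x hy h1 h2 h3)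
    · simp [Mker, if_neg hc]
  calc _ ≤ ∫⁻ x, ∫⁻ t in Set.Ioi (0 : ℝ), ENNReal.ofReal A * (φ t *
        (ENNReal.ofReal (t ^ (-(d : ℝ) / α)) * g (t ^ (-1 / α) • (x - y)))) :=
        lintegral_mono fun x => setLIntegral_mono' measurableSet_Ioi (bound x)
    _ = ∫⁻ t in Set.Ioi (0 : ℝ), ∫⁻ x, ENNReal.ofReal A * (φ t *
        (ENNReal.ofReal (t ^ (-(d : ℝ) / α)) * g (t ^ (-1 / α) • (x - y)))) := by
        refine lintegral_lintegral_swap (Measurable.aemeasurable ?_)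
        simp only [Function.uncurry_def]
        fun_prop
    _ = ∫⁻ t in Set.Ioi (0 : ℝ), ENNReal.ofReal A * (φ t * ∫⁻ z, g z) := by
        refine setLIntegral_congr_fun measurableSet_Ioi fun t ht => ?_
        rw [lintegral_const_mul _ (by fun_prop), lintegral_const_mul _ (by fun_prop),
          lintegral_rescaled_profile d ht y hg]
    _ = ENNReal.ofReal (A * (T ^ (-s / 2 + 1) / (-s / 2 + 1)) * (∫⁻ z, g z).toReal) := by
        have hs : 0 < -s / 2 + 1 := by linarith
        rw [lintegral_const_mul _ (by fun_prop), lintegral_mul_const _ hφ,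
          lintegral_indicator_rpow hT (by linarith), mul_assoc A, ENNReal.ofReal_mul hA,
          ENNReal.ofReal_mul (p := T ^ (-s / 2 + 1) / (-s / 2 + 1)) (by positivity),
          ENNReal.ofReal_toReal hK]
    _ ≤ _ := by rw [hA_def, hT_def, scaling_constant hy0]
end

section
/- Let d ≥ 1 be an integer and 0 < α < 2. Then there exists a constant C < ∞ such that for all x, y ∈ ℝ^d: ∫₀^1 ∫_{ℝ^d} s^{-d/α} (1−s)^{-d/α} · min(1, (1−s)^{1+d/α} / |x−z|^{d+α}) · min(1, s^{1+d/α} / |z−y|^{d+α}) dz ds ≤ C · min(1, |x−y|^{-(d+α)}). -/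
open MeasureTheory Real

/-- The two-sided heat kernel bound for the fractional Laplacian at time `t` and distance `n`,
vanishing at `n = 0` by the conventions for division by zero. -/
noncomputable def fractionalHeatBound (d α t n : ℝ) : ℝ :=
  t ^ (-d / α) * min 1 (t ^ (1 + d / α) / n ^ (d + α))

section Pointwise

variable {d α t s n m r : ℝ}

lemma fractionalHeatBound_nonneg (ht : 0 ≤ t) (hn : 0 ≤ n) :
    0 ≤ fractionalHeatBound d α t n := by
  unfold fractionalHeatBound
  positivity

lemma fractionalHeatBound_le_two_rpow (hd : 0 ≤ d) (hα : 0 < α) (ht : 1 / 2 ≤ t) :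
    fractionalHeatBound d α t n ≤ 2 ^ (d / α) := by
  have ht0 : 0 < t := by linarith
  calc fractionalHeatBound d α t n ≤ t ^ (-d / α) * 1 := by
        unfold fractionalHeatBound
        gcongr
        exact min_le_left _ _
    _ = t⁻¹ ^ (d / α) := by
        rw [mul_one, neg_div, rpow_neg ht0.le, inv_rpow ht0.le]
    _ ≤ 2 ^ (d / α) := by
        have : t⁻¹ ≤ 2 := by
          rw [inv_le_comm₀ ht0 two_pos]
          linarith
        gcongr

lemma fractionalHeatBound_le_two_rpow_mul (hd : 0 ≤ d) (hα : 0 < α) (ht : 0 < t) (ht1 : t ≤ 1)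
    (hr : 0 < r) (hn : r / 2 ≤ n) :
    fractionalHeatBound d α t n ≤ 2 ^ (d + α) * r ^ (-(d + α)) := by
  have hn0 : 0 < n := by linarith
  calc fractionalHeatBound d α t n
      ≤ t ^ (-d / α) * (t ^ (1 + d / α) / n ^ (d + α)) := by
        unfold fractionalHeatBound
        gcongr
        exact min_le_right _ _
    _ = t / n ^ (d + α) := by
        rw [← mul_div_assoc, ← rpow_add ht, neg_div, neg_add_cancel_comm_assoc, rpow_one]
    _ ≤ 1 / (r / 2) ^ (d + α) := by gcongr
    _ = 2 ^ (d + α) * r ^ (-(d + α)) := by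
        rw [div_rpow hr.le zero_le_two, rpow_neg hr.le]
        field_simp

lemma fractionalHeatBound_mul_le (hd : 0 ≤ d) (hα : 0 < α) (ht : 0 < t) (hs : 0 < s)
    (hts : t + s = 1) (hn : 0 ≤ n) (hm : 0 ≤ m) :
    fractionalHeatBound d α t n * fractionalHeatBound d α s m ≤
      2 ^ (d / α) * (fractionalHeatBound d α t n + fractionalHeatBound d α s m) := by
  have h1 := fractionalHeatBound_nonneg (d := d) (α := α) ht.le hn
  have h2 := fractionalHeatBound_nonneg (d := d) (α := α) hs.le hm
  have h3 : (0 : ℝ) ≤ 2 ^ (d / α) := by positivity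
  rcases le_total (1 / 2) t with h | h
  · have := fractionalHeatBound_le_two_rpow (n := n) hd hα h
    nlinarith
  · have := fractionalHeatBound_le_two_rpow (t := s) (n := m) hd hα (by linarith)
    nlinarith

lemma fractionalHeatBound_mul_le_rpow (hd : 0 ≤ d) (hα : 0 < α) (ht : 0 < t) (hs : 0 < s)
    (hts : t + s = 1) (hn : 0 ≤ n) (hm : 0 ≤ m) (hr : 0 < r) (hrnm : r ≤ n + m) :
    fractionalHeatBound d α t n * fractionalHeatBound d α s m ≤
      2 ^ (d + α) * r ^ (-(d + α)) *
        (fractionalHeatBound d α t n + fractionalHeatBound d α s m) := by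
  have h1 := fractionalHeatBound_nonneg (d := d) (α := α) ht.le hn
  have h2 := fractionalHeatBound_nonneg (d := d) (α := α) hs.le hm
  have h3 : (0 : ℝ) ≤ 2 ^ (d + α) * r ^ (-(d + α)) := by positivity
  rcases le_total (r / 2) n with h | h
  · have := fractionalHeatBound_le_two_rpow_mul hd hα ht (by linarith) hr h
    nlinarith
  · have := fractionalHeatBound_le_two_rpow_mul (n := m) hd hα hs (by linarith) hr (by linarith)
    nlinarith

lemma ofReal_fractionalHeatBound_mul_le (hd : 0 ≤ d) (hα : 0 < α) (ht : 0 < t) (hs : 0 < s)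
    (hts : t + s = 1) (hn : 0 ≤ n) (hm : 0 ≤ m) (hr : 0 ≤ r) (hrnm : r ≤ n + m) :
    ENNReal.ofReal (fractionalHeatBound d α t n * fractionalHeatBound d α s m) ≤
      ENNReal.ofReal (2 ^ (d / α) + 2 ^ (d + α)) * min 1 (ENNReal.ofReal r ^ (-(d + α))) *
        (ENNReal.ofReal (fractionalHeatBound d α t n) +
          ENNReal.ofReal (fractionalHeatBound d α s m)) := by
  have h1 := fractionalHeatBound_nonneg (d := d) (α := α) ht.le hn
  have h2 := fractionalHeatBound_nonneg (d := d) (α := α) hs.le hm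
  have key : ENNReal.ofReal (fractionalHeatBound d α t n * fractionalHeatBound d α s m) ≤
      ENNReal.ofReal (2 ^ (d / α) + 2 ^ (d + α)) * 1 *
        (ENNReal.ofReal (fractionalHeatBound d α t n) +
          ENNReal.ofReal (fractionalHeatBound d α s m)) := by
    rw [mul_one, ← ENNReal.ofReal_add h1 h2, ← ENNReal.ofReal_mul (by positivity)]
    refine ENNReal.ofReal_le_ofReal
      ((fractionalHeatBound_mul_le hd hα ht hs hts hn hm).trans ?_)
    gcongr
    exact le_add_of_nonneg_right (by positivity)
  rcases min_choice 1 (ENNReal.ofReal r ^ (-(d + α))) with h | h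
  · rwa [h]
  rcases hr.eq_or_lt with rfl | hr
  · rwa [ENNReal.ofReal_zero, ENNReal.zero_rpow_of_neg (by linarith), min_eq_left le_top]
  rw [h, ENNReal.ofReal_rpow_of_pos hr, ← ENNReal.ofReal_add h1 h2,
    ← ENNReal.ofReal_mul (by positivity), ← ENNReal.ofReal_mul (by positivity)]
  refine ENNReal.ofReal_le_ofReal
    ((fractionalHeatBound_mul_le_rpow hd hα ht hs hts hn hm hr hrnm).trans ?_)
  gcongr
  exact le_add_of_nonneg_left (by positivity)

lemma fractionalHeatBound_one_le (hd : 0 ≤ d) (hα : 0 < α) (hn : 0 ≤ n) :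
    fractionalHeatBound d α 1 n ≤ 2 ^ (d + α) * (1 + n) ^ (-(d + α)) := by
  have h : 2 ^ (d + α) * (1 + n) ^ (-(d + α)) = (2 / (1 + n)) ^ (d + α) := by
    rw [div_rpow zero_le_two (by positivity), rpow_neg (by positivity), div_eq_mul_inv]
  simp only [fractionalHeatBound, one_rpow, one_mul]
  rw [h]
  rcases le_total n 1 with h1 | h1
  · refine (min_le_left _ _).trans (one_le_rpow ?_ (by positivity))
    rw [one_le_div (by positivity)]
    linarith
  · refine (min_le_right _ _).trans ?_
    rw [← one_rpow (d + α), ← div_rpow zero_le_one hn, one_rpow]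
    refine rpow_le_rpow (by positivity) ?_ (by positivity)
    rw [div_le_div_iff₀ (by positivity) (by positivity)]
    linarith

lemma fractionalHeatBound_eq_scaling (hα : 0 < α) (ht : 0 < t) (hn : 0 ≤ n) :
    fractionalHeatBound d α t n =
      t ^ (-d / α) * fractionalHeatBound d α 1 (t ^ (-1 / α) * n) := by
  have h : (t ^ (-1 / α)) ^ (d + α) = (t ^ (1 + d / α))⁻¹ := by
    rw [← rpow_mul ht.le, ← rpow_neg ht.le]
    congr 1
    field_simp
    ring
  simp only [fractionalHeatBound, one_rpow, one_mul]
  rw [mul_rpow (by positivity) hn, h, one_div, mul_inv, inv_inv, div_eq_mul_inv (t ^ (1 + d / α))]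

end Pointwise

section Integral

variable {E : Type*} [NormedAddCommGroup E] [NormedSpace ℝ E] [FiniteDimensional ℝ E]
  [MeasurableSpace E] [BorelSpace E] (μ : Measure E) [μ.IsAddHaarMeasure] {α t : ℝ}

@[fun_prop]
lemma measurable_fractionalHeatBound {d α t : ℝ} : Measurable (fractionalHeatBound d α t) := by
  unfold fractionalHeatBound
  fun_prop

lemma lintegral_fractionalHeatBound_one_lt_top (hα : 0 < α) :
    ∫⁻ z, ENNReal.ofReal (fractionalHeatBound (Module.finrank ℝ E) α 1 ‖z‖) ∂μ < ⊤ := by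
  calc _ ≤ ∫⁻ z : E, ENNReal.ofReal (2 ^ (Module.finrank ℝ E + α)) *
          ENNReal.ofReal ((1 + ‖z‖) ^ (-(Module.finrank ℝ E + α))) ∂μ := by
        gcongr with z
        rw [← ENNReal.ofReal_mul (by positivity)]
        exact ENNReal.ofReal_le_ofReal
          (fractionalHeatBound_one_le (by positivity) hα (norm_nonneg z))
    _ < ⊤ := by
        rw [lintegral_const_mul' _ _ ENNReal.ofReal_ne_top]
        exact ENNReal.mul_lt_top ENNReal.ofReal_lt_top
          (finite_integral_one_add_norm (by linarith))

lemma lintegral_fractionalHeatBound_eq (hα : 0 < α) (ht : 0 < t) :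
    ∫⁻ z, ENNReal.ofReal (fractionalHeatBound (Module.finrank ℝ E) α t ‖z‖) ∂μ =
      ∫⁻ z, ENNReal.ofReal (fractionalHeatBound (Module.finrank ℝ E) α 1 ‖z‖) ∂μ := by
  have hc : 0 < t ^ (-1 / α) := by positivity
  have hmap := Measure.map_addHaar_smul μ hc.ne'
  have hpow : (t ^ (-1 / α)) ^ Module.finrank ℝ E = t ^ (-(Module.finrank ℝ E : ℝ) / α) := by
    rw [← rpow_natCast, ← rpow_mul ht.le]
    congr 1
    ring
  have hpos : 0 < t ^ (-(Module.finrank ℝ E : ℝ) / α) := by positivity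
  calc _ = ∫⁻ z : E, ENNReal.ofReal (t ^ (-(Module.finrank ℝ E : ℝ) / α)) *
          ENNReal.ofReal (fractionalHeatBound (Module.finrank ℝ E) α 1 ‖t ^ (-1 / α) • z‖) ∂μ := by
        refine lintegral_congr fun z ↦ ?_
        rw [← ENNReal.ofReal_mul hpos.le, norm_smul, norm_of_nonneg hc.le,
          ← fractionalHeatBound_eq_scaling hα ht (norm_nonneg z)]
    _ = ENNReal.ofReal (t ^ (-(Module.finrank ℝ E : ℝ) / α)) *
          ∫⁻ z, ENNReal.ofReal (fractionalHeatBound (Module.finrank ℝ E) α 1 ‖z‖)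
            ∂(μ.map (t ^ (-1 / α) • ·)) := by
        rw [lintegral_const_mul' _ _ ENNReal.ofReal_ne_top,
          lintegral_map (by fun_prop) (by fun_prop)]
    _ = _ := by
        rw [hmap, lintegral_smul_measure, hpow, abs_of_pos (inv_pos.2 hpos), smul_eq_mul,
          ← mul_assoc, ← ENNReal.ofReal_mul hpos.le, mul_inv_cancel₀ hpos.ne',
          ENNReal.ofReal_one, one_mul]

end Integral

/-- Semigroup-type estimate: the Duhamel integral of the two-sided fractional heat kernel
bounds is controlled by `C · min(1, |x-y|^{-(d+α)})` (in `ℝ≥0∞`, so that the right-hand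
side equals `C` when `x = y`). -/
theorem duhamel_semigroup_bound (d : ℕ) (hd : 1 ≤ d) (α : ℝ) (hα0 : 0 < α) (hα2 : α < 2) :
    ∃ C : ℝ, ∀ x y : EuclideanSpace ℝ (Fin d),
      (∫⁻ s in Set.Ioo (0 : ℝ) 1, ∫⁻ z : EuclideanSpace ℝ (Fin d),
        ENNReal.ofReal (s ^ (-(d : ℝ) / α) * (1 - s) ^ (-(d : ℝ) / α) *
          min 1 ((1 - s) ^ (1 + (d : ℝ) / α) / ‖x - z‖ ^ ((d : ℝ) + α)) *
          min 1 (s ^ (1 + (d : ℝ) / α) / ‖z - y‖ ^ ((d : ℝ) + α))))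
        ≤ ENNReal.ofReal C * min 1 ((ENNReal.ofReal ‖x - y‖) ^ (-((d : ℝ) + α))) := by
  set γ : ℝ := (d : ℝ) + α with hγ
  have hfin : Module.finrank ℝ (EuclideanSpace ℝ (Fin d)) = d := by simp
  set I : ENNReal := ∫⁻ z : EuclideanSpace ℝ (Fin d),
    ENNReal.ofReal (fractionalHeatBound d α 1 ‖z‖)
  have hItop : I < ⊤ := by
    have := lintegral_fractionalHeatBound_one_lt_top
      (volume : Measure (EuclideanSpace ℝ (Fin d))) hα0
    rwa [hfin] at this
  have hint : ∀ t : ℝ, 0 < t → ∫⁻ z : EuclideanSpace ℝ (Fin d),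
      ENNReal.ofReal (fractionalHeatBound d α t ‖z‖) = I := fun t ht ↦ by
    have := lintegral_fractionalHeatBound_eq
      (volume : Measure (EuclideanSpace ℝ (Fin d))) hα0 ht
    rwa [hfin] at this
  refine ⟨(2 ^ (d / α) + 2 ^ γ) * (I + I).toReal, fun x y ↦ ?_⟩
  set M : ENNReal := min 1 (ENNReal.ofReal ‖x - y‖ ^ (-γ))
  set K : ENNReal := ENNReal.ofReal (2 ^ (d / α) + 2 ^ γ)
  have hMtop : K * M ≠ ⊤ :=
    ENNReal.mul_ne_top ENNReal.ofReal_ne_top (min_lt_of_left_lt ENNReal.one_lt_top).ne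
  have hslice : ∀ s ∈ Set.Ioo (0 : ℝ) 1, ∫⁻ z : EuclideanSpace ℝ (Fin d),
      ENNReal.ofReal (s ^ (-(d : ℝ) / α) * (1 - s) ^ (-(d : ℝ) / α) *
        min 1 ((1 - s) ^ (1 + (d : ℝ) / α) / ‖x - z‖ ^ γ) *
        min 1 (s ^ (1 + (d : ℝ) / α) / ‖z - y‖ ^ γ)) ≤ K * M * (I + I) := by
    rintro s ⟨hs0, hs1⟩
    have ht0 : 0 < 1 - s := by linarith
    calc _ ≤ ∫⁻ z : EuclideanSpace ℝ (Fin d), K * M *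
          (ENNReal.ofReal (fractionalHeatBound d α (1 - s) ‖x - z‖) +
            ENNReal.ofReal (fractionalHeatBound d α s ‖z - y‖)) := by
          gcongr with z
          convert ofReal_fractionalHeatBound_mul_le d.cast_nonneg hα0 ht0 hs0 (by ring)
            (norm_nonneg (x - z)) (norm_nonneg (z - y)) (norm_nonneg (x - y))
            (norm_sub_le_norm_sub_add_norm_sub x z y) using 2
          unfold fractionalHeatBound
          ring
      _ = K * M * (I + I) := by
          rw [lintegral_const_mul' _ _ hMtop, lintegral_add_left (by fun_prop),
            lintegral_sub_left_eq_self
              (fun z ↦ ENNReal.ofReal (fractionalHeatBound d α (1 - s) ‖z‖)) x,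
            lintegral_sub_right_eq_self
              (fun z ↦ ENNReal.ofReal (fractionalHeatBound d α s ‖z‖)) y,
            hint _ ht0, hint _ hs0]
  calc _ ≤ ∫⁻ _ in Set.Ioo (0 : ℝ) 1, K * M * (I + I) :=
        setLIntegral_mono measurable_const hslice
    _ = K * M * (I + I) := by simp
    _ = _ := by
        rw [ENNReal.ofReal_mul (by positivity),
          ENNReal.ofReal_toReal (ENNReal.add_ne_top.2 ⟨hItop.ne, hItop.ne⟩)]
        ring
end
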